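/- (Complete asymptotic expansion.) Let j ∈ ℤ, q ≥ 1 an integer and x > 0. Let f ∈ E be such that f is (2q−1) times differentiable on a neighborhood of x and f^(2q-1) is differentiable at x. Then n^q · ( (S_{n,j}f)(x) − f(x) − ∑_{k=1}^{q} (1/(k! n^k)) · c_k ) → 0 as n → ∞, where c_k := k! ∑_{s=0}^{k} (x^s/s!) · ((k−j)↓(k−s)/(k−s)!) · f^{(k+s)}(x), which for f of class C^{2k} near x equals (D_j^{2k} f)(x) = x^j · d^k/dx^k ( x^{k-j} f^{(k)}(x) ). -/

import Mathlib

open MeasureTheory Real Filter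

/-- Szász basis function `s_{n,k}(x)` for natural index `k`. -/
noncomputable def szasz (n k : ℕ) (x : ℝ) : ℝ :=
  Real.exp (-(n : ℝ) * x) * ((n : ℝ) * x) ^ k / (Nat.factorial k)

/-- Szász basis function for integer index, vanishing for negative index. -/
noncomputable def szaszZ (n : ℕ) (k : ℤ) (x : ℝ) : ℝ :=
  if 0 ≤ k then szasz n k.toNat x else 0

/-- The generalized Szász–Mirakjan–Durrmeyer operator `S_{n,j}`. -/
noncomputable def Sop (n : ℕ) (j : ℤ) (f : ℝ → ℝ) (x : ℝ) : ℝ :=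
  f 0 * ∑ k ∈ Finset.range j.toNat, szasz n k x
    + ∑' (k : ℕ), szasz n k x *
        ((n : ℝ) * ∫ t in Set.Ioi (0 : ℝ), szaszZ n ((k : ℤ) - j) t * f t)

/-- Membership in the class `E_A`: locally integrable on `[0,∞)` with exponential growth. -/
def MemE (A : ℝ) (f : ℝ → ℝ) : Prop :=
  MeasureTheory.LocallyIntegrableOn f (Set.Ici 0) ∧
    ∃ K > 0, ∀ t ≥ (0 : ℝ), |f t| ≤ K * Real.exp (A * t)

/-- Falling factorial `a↓r = a(a-1)⋯(a-r+1)` for integer `a`. -/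
def ffall (a : ℤ) (r : ℕ) : ℤ := ∏ i ∈ Finset.range r, (a - i)

lemma integrableOn_pow_mul_exp_neg_Ioi (m : ℕ) {r : ℝ} (hr : 0 < r) :
    IntegrableOn (fun t : ℝ => t ^ m * Real.exp (-(r * t))) (Set.Ioi 0) := by
  have h := integrableOn_rpow_mul_exp_neg_mul_rpow (p := 1) (s := m) (b := r)
    (by have : (0 : ℝ) ≤ m := m.cast_nonneg
        linarith) one_pos hr
  refine h.congr_fun (fun t _ => ?_) measurableSet_Ioi
  simp

lemma integral_pow_mul_exp_neg_Ioi (m : ℕ) {r : ℝ} (hr : 0 < r) :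
    ∫ t in Set.Ioi (0 : ℝ), t ^ m * Real.exp (-(r * t)) = m.factorial / r ^ (m + 1) := by
  have h := Real.integral_rpow_mul_exp_neg_mul_Ioi (a := m + 1) (r := r) (by positivity) hr
  rw [Real.Gamma_nat_eq_factorial] at h
  simp only [add_sub_cancel_right, Real.rpow_natCast] at h
  rw [h]
  rw [show ((m : ℝ) + 1) = ((m + 1 : ℕ) : ℝ) by push_cast; ring, Real.rpow_natCast, one_div,
    inv_pow, mul_comm, div_eq_mul_inv]

lemma szasz_nonneg {n k : ℕ} {x : ℝ} (hx : 0 ≤ x) : 0 ≤ szasz n k x := by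
  unfold szasz; positivity

lemma szaszZ_nonneg {n : ℕ} {k : ℤ} {x : ℝ} (hx : 0 ≤ x) : 0 ≤ szaszZ n k x := by
  unfold szaszZ; split_ifs
  · exact szasz_nonneg hx
  · exact le_rfl

lemma continuous_szaszZ (n : ℕ) (k : ℤ) : Continuous (szaszZ n k) := by
  unfold szaszZ szasz; split_ifs <;> fun_prop

lemma szaszZ_mul_exp (n p : ℕ) (b t : ℝ) :
    szaszZ n p t * Real.exp (b * t) =
      (n : ℝ) ^ p / p.factorial * (t ^ p * Real.exp (-((n - b) * t))) := by
  have : Real.exp (-((n - b) * t)) = Real.exp (-(n : ℝ) * t) * Real.exp (b * t) := by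
    rw [← Real.exp_add]; ring_nf
  rw [this]
  simp only [szaszZ, szasz, Nat.cast_nonneg, if_true, Int.toNat_natCast]
  ring

lemma szaszZ_mul_pow (n p m : ℕ) (t : ℝ) :
    szaszZ n p t * t ^ m =
      (n : ℝ) ^ p / p.factorial * (t ^ (p + m) * Real.exp (-(n * t))) := by
  simp only [szaszZ, szasz, Nat.cast_nonneg, if_true, Int.toNat_natCast]
  ring_nf

lemma szaszZ_of_neg (n : ℕ) {k : ℤ} (hk : k < 0) (t : ℝ) : szaszZ n k t = 0 := by
  simp [szaszZ, not_le.2 hk]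

lemma integrableOn_szaszZ_mul_exp (n : ℕ) (k : ℤ) {b : ℝ} (hb : b < n) :
    IntegrableOn (fun t : ℝ => szaszZ n k t * Real.exp (b * t)) (Set.Ioi 0) := by
  rcases lt_or_ge k 0 with hk | hk
  · simp [szaszZ_of_neg n hk]
  · lift k to ℕ using hk
    simp only [szaszZ_mul_exp]
    exact (integrableOn_pow_mul_exp_neg_Ioi k (sub_pos.2 hb)).const_mul _

/-- The Laplace transform of the Szász basis functions. -/
lemma mul_integral_szaszZ_mul_exp (n p : ℕ) {b : ℝ} (hb : b < n) :
    n * ∫ t in Set.Ioi (0 : ℝ), szaszZ n p t * Real.exp (b * t) =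
      ((n : ℝ) / (n - b)) ^ (p + 1) := by
  simp only [szaszZ_mul_exp]
  rw [integral_const_mul, integral_pow_mul_exp_neg_Ioi p (sub_pos.2 hb), div_pow]
  have := p.factorial_ne_zero
  rw [pow_succ (n : ℝ)]
  field_simp

lemma mul_integral_szaszZ_mul_pow {n : ℕ} (hn : 0 < n) (p m : ℕ) :
    n * ∫ t in Set.Ioi (0 : ℝ), szaszZ n p t * t ^ m =
      ((p + m).factorial : ℝ) / (p.factorial * (n : ℝ) ^ m) := by
  simp only [szaszZ_mul_pow]
  have hn' : (0 : ℝ) < n := by exact_mod_cast hn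
  rw [integral_const_mul, integral_pow_mul_exp_neg_Ioi (p + m) hn']
  rw [pow_succ (n : ℝ), pow_add]
  field_simp

lemma hasSum_szasz_mul_pow (n : ℕ) (x z : ℝ) :
    HasSum (fun k => szasz n k x * z ^ k) (Real.exp (n * x * (z - 1))) := by
  have h := NormedSpace.expSeries_div_hasSum_exp (𝔸 := ℝ) (n * x * z)
  rw [← Real.exp_eq_exp_ℝ] at h
  have h2 := h.mul_left (Real.exp (-(n : ℝ) * x))
  rw [← Real.exp_add] at h2
  have e1 : (fun k => szasz n k x * z ^ k) =
      fun k => Real.exp (-(n : ℝ) * x) * ((n * x * z) ^ k / k.factorial) := by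
    ext k; unfold szasz; ring
  rw [e1, show (n : ℝ) * x * (z - 1) = -(n : ℝ) * x + n * x * z by ring]
  exact h2

lemma hasSum_szasz_mul_descFactorial (n s : ℕ) (x : ℝ) :
    HasSum (fun k => szasz n k x * (k.descFactorial s : ℝ)) ((n * x) ^ s) := by
  have h0 := (hasSum_szasz_mul_pow n x 1).mul_left ((n * x) ^ s)
  simp only [one_pow, mul_one, sub_self, mul_zero, Real.exp_zero] at h0
  have hz : ∑ i ∈ Finset.range s, szasz n i x * (i.descFactorial s : ℝ) = 0 :=
    Finset.sum_eq_zero fun i hi => by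
      rw [Nat.descFactorial_of_lt (Finset.mem_range.1 hi)]; simp
  have h1 := (hasSum_nat_add_iff (f := fun k => szasz n k x * (k.descFactorial s : ℝ))
    (g := (n * x) ^ s) s)
  rw [hz, add_zero] at h1
  refine h1.1 (h0.congr_fun fun k => ?_)
  have h2 := Nat.factorial_mul_descFactorial (Nat.le_add_left s k)
  rw [Nat.add_sub_cancel] at h2
  simp only [szasz, ← h2]
  have h3 : ((k + s).descFactorial s : ℝ) ≠ 0 := by
    have := Nat.pos_iff_ne_zero.1 (Nat.descFactorial_pos.2 (Nat.le_add_left s k))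
    exact_mod_cast this
  push_cast
  field_simp
  ring

lemma zpow_le_two_pow {z : ℝ} (h1 : 1 / 2 ≤ z) (h2 : z ≤ 2) (i : ℤ) : z ^ i ≤ 2 ^ i.natAbs := by
  have hz : 0 < z := by linarith
  rcases Int.natAbs_eq i with h | h
  · rw [h, zpow_natCast, Int.natAbs_natCast]; gcongr
  · rw [h, zpow_neg, zpow_natCast, Int.natAbs_neg, Int.natAbs_natCast, ← inv_pow]
    gcongr
    rw [inv_le_comm₀ hz two_pos]; linarith

/-- Upper bound for the Durrmeyer coefficients of an exponential. -/
lemma mul_integral_szaszZ_mul_exp_le (n k : ℕ) (j : ℤ) {b : ℝ} (hb : b < n)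
    (h1 : 1 / 2 ≤ (n : ℝ) / (n - b)) (h2 : (n : ℝ) / (n - b) ≤ 2) :
    n * ∫ t in Set.Ioi (0 : ℝ), szaszZ n (k - j) t * Real.exp (b * t) ≤
      2 ^ (1 - j).natAbs * ((n : ℝ) / (n - b)) ^ k := by
  set z := (n : ℝ) / (n - b) with hz
  have hz0 : 0 < z := by linarith
  rcases lt_or_ge ((k : ℤ) - j) 0 with hk | hk
  · simp only [szaszZ_of_neg n hk, zero_mul, integral_zero, mul_zero]; positivity
  · obtain ⟨p, hp⟩ := Int.eq_ofNat_of_zero_le hk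
    rw [hp, mul_integral_szaszZ_mul_exp n p hb, ← hz]
    have : z ^ (p + 1) = z ^ (1 - j) * z ^ k := by
      rw [← zpow_natCast, ← zpow_natCast, ← zpow_add₀ hz0.ne']
      congr 1; push_cast; linarith
    rw [this]
    gcongr
    exact zpow_le_two_pow h1 h2 _

/-- The series defining the integral part of `S_{n,j} g` is well-defined. -/
structure Admissible (n : ℕ) (j : ℤ) (x : ℝ) (g : ℝ → ℝ) : Prop where
  integrableOn : ∀ k : ℕ, IntegrableOn (fun t => szaszZ n (k - j) t * g t) (Set.Ioi 0)
  summable : Summable fun k : ℕ =>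
    szasz n k x * (n * ∫ t in Set.Ioi (0 : ℝ), szaszZ n (k - j) t * g t)

/-- The integral part of the operator `S_{n,j}`. -/
noncomputable def sopIntegral (n : ℕ) (j : ℤ) (x : ℝ) (g : ℝ → ℝ) : ℝ :=
  ∑' k : ℕ, szasz n k x * (n * ∫ t in Set.Ioi (0 : ℝ), szaszZ n (k - j) t * g t)

namespace Admissible

variable {n : ℕ} {j : ℤ} {x : ℝ} {g h : ℝ → ℝ}

lemma const_mul (hg : Admissible n j x g) (c : ℝ) :
    Admissible n j x (fun t => c * g t) ∧
      sopIntegral n j x (fun t => c * g t) = c * sopIntegral n j x g := by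
  have key : ∀ k : ℕ, szasz n k x * (n * ∫ t in Set.Ioi (0 : ℝ), szaszZ n (k - j) t * (c * g t)) =
      c * (szasz n k x * (n * ∫ t in Set.Ioi (0 : ℝ), szaszZ n (k - j) t * g t)) := fun k => by
    simp only [mul_left_comm _ c, integral_const_mul]
  refine ⟨⟨fun k => ?_, ?_⟩, ?_⟩
  · simp only [mul_left_comm _ c]
    exact Integrable.const_mul (hg.integrableOn k) c
  · simpa only [key] using hg.summable.mul_left c
  · simp only [sopIntegral, key, tsum_mul_left]

lemma add (hg : Admissible n j x g) (hh : Admissible n j x h) :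
    Admissible n j x (fun t => g t + h t) ∧
      sopIntegral n j x (fun t => g t + h t) = sopIntegral n j x g + sopIntegral n j x h := by
  have key : ∀ k : ℕ, szasz n k x * (n * ∫ t in Set.Ioi (0 : ℝ), szaszZ n (k - j) t * (g t + h t)) =
      szasz n k x * (n * ∫ t in Set.Ioi (0 : ℝ), szaszZ n (k - j) t * g t) +
      szasz n k x * (n * ∫ t in Set.Ioi (0 : ℝ), szaszZ n (k - j) t * h t) := fun k => by
    simp only [mul_add]
    rw [integral_add (hg.integrableOn k) (hh.integrableOn k)]; ring
  refine ⟨⟨fun k => ?_, ?_⟩, ?_⟩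
  · simp only [mul_add]
    exact (hg.integrableOn k).add (hh.integrableOn k)
  · simpa only [key] using hg.summable.add hh.summable
  · simp only [sopIntegral, key, hg.summable.tsum_add hh.summable]

lemma sum {ι : Type*} (s : Finset ι) (c : ι → ℝ) (G : ι → ℝ → ℝ)
    (hG : ∀ i ∈ s, Admissible n j x (G i)) :
    Admissible n j x (fun t => ∑ i ∈ s, c i * G i t) ∧
      sopIntegral n j x (fun t => ∑ i ∈ s, c i * G i t) =
        ∑ i ∈ s, c i * sopIntegral n j x (G i) := by
  classical
  induction s using Finset.induction_on with
  | empty =>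
    refine ⟨⟨fun k => ?_, ?_⟩, ?_⟩ <;> simp [sopIntegral, summable_zero]
  | insert a s ha ih =>
    have h1 := ih fun i hi => hG i (Finset.mem_insert_of_mem hi)
    have h2 := (hG a (Finset.mem_insert_self a s)).const_mul (c a)
    have h3 := h2.1.add h1.1
    simp only [Finset.sum_insert ha]
    exact ⟨h3.1, by rw [h3.2, h2.2, h1.2]⟩

end Admissible

/-- A function dominated by `C (e^{√n (t - x)} + e^{-√n (t - x)})` is admissible, and the operator
is bounded on such functions uniformly in `n`. -/
lemma admissible_of_le_exp_sqrt {n : ℕ} {w : ℝ} (hw : 2 ≤ w) (hwn : w ^ 2 = n) (j : ℤ) {x : ℝ}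
    (hx : 0 ≤ x) {g : ℝ → ℝ} {C : ℝ}
    (hgm : AEStronglyMeasurable g (volume.restrict (Set.Ioi 0)))
    (hg : ∀ t > 0, |g t| ≤ C * (Real.exp (w * (t - x)) + Real.exp (-w * (t - x)))) :
    Admissible n j x g ∧
      |sopIntegral n j x g| ≤ C * (2 ^ (1 - j).natAbs * (2 * Real.exp (2 * x))) := by
  have hn : 0 < n := by
    have : (0 : ℝ) < n := by rw [← hwn]; positivity
    exact_mod_cast this
  have hC : 0 ≤ C := by
    by_contra! hC
    have h1 := hg 1 one_pos
    have h2 : C * (Real.exp (w * (1 - x)) + Real.exp (-w * (1 - x))) < 0 :=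
      mul_neg_of_neg_of_pos hC (by positivity)
    linarith [abs_nonneg (g 1)]
  have hb1 : w < n := by rw [← hwn]; nlinarith
  have hb2 : -w < n := by rw [← hwn]; nlinarith
  have hdom : ∀ k : ℕ, IntegrableOn (fun t => C * (Real.exp (-w * x) * (szaszZ n (k - j) t *
      Real.exp (w * t)) + Real.exp (w * x) * (szaszZ n (k - j) t * Real.exp (-w * t))))
      (Set.Ioi 0) := fun k =>
    (((integrableOn_szaszZ_mul_exp n _ hb1).const_mul _).add
      ((integrableOn_szaszZ_mul_exp n _ hb2).const_mul _)).const_mul _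
  have hle : ∀ k : ℕ, ∀ᵐ t ∂(volume.restrict (Set.Ioi (0 : ℝ))), ‖szaszZ n (k - j) t * g t‖ ≤
      C * (Real.exp (-w * x) * (szaszZ n (k - j) t *
      Real.exp (w * t)) + Real.exp (w * x) * (szaszZ n (k - j) t * Real.exp (-w * t))) := by
    intro k
    filter_upwards [ae_restrict_mem measurableSet_Ioi] with t ht
    have h0 : 0 ≤ szaszZ n (k - j) t := szaszZ_nonneg (le_of_lt ht)
    rw [norm_mul, Real.norm_of_nonneg h0, Real.norm_eq_abs]
    refine (mul_le_mul_of_nonneg_left (hg t ht) h0).trans_eq ?_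
    have e1 : Real.exp (w * (t - x)) = Real.exp (-w * x) * Real.exp (w * t) := by
      rw [← Real.exp_add]; ring_nf
    have e2 : Real.exp (-w * (t - x)) = Real.exp (w * x) * Real.exp (-w * t) := by
      rw [← Real.exp_add]; ring_nf
    rw [e1, e2]; ring
  have hint : ∀ k : ℕ, IntegrableOn (fun t => szaszZ n (k - j) t * g t) (Set.Ioi 0) := fun k =>
    (hdom k).mono' ((continuous_szaszZ n _).aestronglyMeasurable.mul hgm) (hle k)
  set z₁ := (n : ℝ) / (n - w) with hz₁
  set z₂ := (n : ℝ) / (n - -w) with hz₂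
  have e₁ : z₁ = w / (w - 1) := by
    have : w - 1 ≠ 0 := by linarith
    rw [hz₁, ← hwn]; field_simp
  have e₂ : z₂ = w / (w + 1) := by
    rw [hz₂, ← hwn]; rw [sub_neg_eq_add, show w ^ 2 + w = w * (w + 1) by ring]; field_simp
  set B : ℝ := 2 ^ (1 - j).natAbs with hB
  have hB0 : 0 ≤ B := by positivity
  have hterm : ∀ k : ℕ, ‖szasz n k x * (n * ∫ t in Set.Ioi (0 : ℝ), szaszZ n (k - j) t * g t)‖ ≤
      C * (B * (Real.exp (-w * x) * (szasz n k x * z₁ ^ k) +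
        Real.exp (w * x) * (szasz n k x * z₂ ^ k))) := by
    intro k
    have i1 := norm_integral_le_of_norm_le (hdom k) (hle k)
    rw [integral_const_mul, integral_add ((integrableOn_szaszZ_mul_exp n _ hb1).const_mul _)
      ((integrableOn_szaszZ_mul_exp n _ hb2).const_mul _), integral_const_mul,
      integral_const_mul] at i1
    have j1 := mul_integral_szaszZ_mul_exp_le n k j hb1
      (by rw [← hz₁, e₁, div_le_div_iff₀ two_pos (by linarith)]; linarith)
      (by rw [← hz₁, e₁, div_le_iff₀ (by linarith)]; linarith)
    have j2 := mul_integral_szaszZ_mul_exp_le n k j hb2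
      (by rw [← hz₂, e₂, div_le_div_iff₀ two_pos (by linarith)]; linarith)
      (by rw [← hz₂, e₂, div_le_iff₀ (by linarith)]; linarith)
    have hs : 0 ≤ szasz n k x := szasz_nonneg hx
    rw [norm_mul, norm_mul, Real.norm_of_nonneg hs, Real.norm_of_nonneg (n.cast_nonneg : (0 : ℝ) ≤ n)]
    calc _ ≤ szasz n k x * (n * _) :=
          mul_le_mul_of_nonneg_left (mul_le_mul_of_nonneg_left i1 n.cast_nonneg) hs
      _ = szasz n k x * (C * (Real.exp (-w * x) * (n * ∫ t in Set.Ioi (0 : ℝ),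
            szaszZ n (k - j) t * Real.exp (w * t)) + Real.exp (w * x) * (n *
            ∫ t in Set.Ioi (0 : ℝ), szaszZ n (k - j) t * Real.exp (-w * t)))) := by ring
      _ ≤ szasz n k x * (C * (Real.exp (-w * x) * (B * z₁ ^ k) + Real.exp (w * x) *
            (B * z₂ ^ k))) := by gcongr
      _ = _ := by ring
  have hsum := ((((hasSum_szasz_mul_pow n x z₁).mul_left (Real.exp (-w * x))).add
    ((hasSum_szasz_mul_pow n x z₂).mul_left (Real.exp (w * x)))).mul_left B).mul_left C
  refine ⟨⟨hint, Summable.of_norm_bounded hsum.summable hterm⟩, ?_⟩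
  refine (tsum_of_norm_bounded hsum hterm).trans ?_
  rw [← Real.exp_add, ← Real.exp_add, two_mul (Real.exp _)]
  have q1 : -w * x + n * x * (z₁ - 1) ≤ 2 * x := by
    have : -w * x + n * x * (z₁ - 1) = w / (w - 1) * x := by
      have : w - 1 ≠ 0 := by linarith
      rw [e₁, ← hwn]; field_simp; ring
    rw [this]
    gcongr
    rw [div_le_iff₀ (by linarith)]; linarith
  have q2 : w * x + n * x * (z₂ - 1) ≤ 2 * x := by
    have : w * x + n * x * (z₂ - 1) = w / (w + 1) * x := by
      rw [e₂, ← hwn]; field_simp; ring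
    rw [this]
    gcongr
    rw [div_le_iff₀ (by linarith)]; linarith
  gcongr

/-- A function of exponential type is admissible for large `n`. -/
lemma admissible_of_le_exp {n : ℕ} (hn : 4 ≤ n) {a : ℝ} (ha : 0 ≤ a) (han : a ^ 2 ≤ n) (j : ℤ) {x : ℝ}
    (hx : 0 ≤ x) {g : ℝ → ℝ} {C : ℝ} (hC : 0 ≤ C)
    (hgm : AEStronglyMeasurable g (volume.restrict (Set.Ioi 0)))
    (hg : ∀ t > 0, |g t| ≤ C * Real.exp (a * t)) : Admissible n j x g := by
  have hn' : (4 : ℝ) ≤ n := by exact_mod_cast hn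
  have hw : 2 ≤ √(n : ℝ) := Real.le_sqrt_of_sq_le (by linarith)
  have haw : a ≤ √(n : ℝ) := Real.le_sqrt_of_sq_le han
  refine (admissible_of_le_exp_sqrt (C := C * Real.exp (a * x)) hw
    (Real.sq_sqrt n.cast_nonneg) j hx hgm fun t ht => (hg t ht).trans ?_).1
  have : Real.exp (a * t) = Real.exp (a * x) * Real.exp (a * (t - x)) := by
    rw [← Real.exp_add]; ring_nf
  rw [this, mul_assoc]
  gcongr
  rcases le_total x t with h | h
  · have : Real.exp (a * (t - x)) ≤ Real.exp (√n * (t - x)) := by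
      have := sub_nonneg.2 h
      gcongr
    linarith [Real.exp_pos (-√n * (t - x))]
  · have : Real.exp (a * (t - x)) ≤ Real.exp (-√n * (t - x)) := by
      have := sub_nonneg.2 h
      apply Real.exp_le_exp.2
      nlinarith [Real.sqrt_nonneg (n : ℝ)]
    linarith [Real.exp_pos (√n * (t - x))]

lemma ffall_eq_factorial_mul_choose (a : ℤ) (r : ℕ) :
    ffall a r = r.factorial * Ring.choose a r := by
  have h := Ring.descPochhammer_eq_factorial_smul_choose a r
  rw [nsmul_eq_mul] at h
  rw [← h, ← Polynomial.eval_eq_smeval]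
  unfold ffall
  exact (descPochhammer_eval_eq_prod_range r a).symm

lemma ffall_div_factorial (a : ℤ) (r : ℕ) :
    (ffall a r : ℝ) / r.factorial = (Ring.choose a r : ℤ) := by
  have := r.factorial_ne_zero
  rw [ffall_eq_factorial_mul_choose]
  push_cast
  field_simp

lemma choose_add_eq_sum_range (a b : ℤ) (r : ℕ) :
    Ring.choose (a + b) r =
      ∑ s ∈ Finset.range (r + 1), Ring.choose a s * Ring.choose b (r - s) := by
  rw [Ring.add_choose_eq r (Commute.all a b), Finset.Nat.sum_antidiagonal_eq_sum_range_succ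
    (fun u v => Ring.choose a u * Ring.choose b v)]

/-- Closed form of the `k`-th expansion coefficient for the monomial `t ^ m`. -/
lemma sum_choose_mul_descFactorial (j : ℤ) (k m : ℕ) (x : ℝ) :
    ∑ s ∈ Finset.range (k + 1), x ^ s / s.factorial *
      ((ffall ((k : ℤ) - j) (k - s) : ℝ) / (k - s).factorial) *
        ((m.descFactorial (k + s) : ℝ) * x ^ (m - (k + s))) =
      m.descFactorial k * (Ring.choose ((m : ℤ) - j) k : ℤ) * x ^ (m - k) := by
  rcases lt_or_ge m k with hmk | hkm
  · rw [Nat.descFactorial_of_lt hmk]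
    simp only [Nat.cast_zero, zero_mul]
    refine Finset.sum_eq_zero fun s _ => ?_
    rw [Nat.descFactorial_of_lt (by omega)]; simp
  · have h : (m : ℤ) - j = ((m - k : ℕ) : ℤ) + (k - j) := by omega
    rw [h, choose_add_eq_sum_range, Int.cast_sum, Finset.mul_sum, Finset.sum_mul]
    refine Finset.sum_congr rfl fun s _ => ?_
    rw [ffall_div_factorial, Ring.choose_natCast]
    rcases lt_or_ge (m - k) s with hs | hs
    · rw [Nat.choose_eq_zero_of_lt hs, Nat.descFactorial_of_lt (by omega)]; simp
    · have h1 := Nat.descFactorial_mul_descFactorial (n := m) (Nat.le_add_right k s)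
      rw [Nat.add_sub_cancel_left, Nat.descFactorial_eq_factorial_mul_choose (m - k)] at h1
      rw [← h1, show m - k = s + (m - (k + s)) by omega, pow_add]
      have := s.factorial_ne_zero
      push_cast
      field_simp

/-- The operator on monomials: the full series is a polynomial in `1 / n`, and for `j > 0`
finitely many terms are missing. -/
lemma sopIntegral_pow {n : ℕ} (hn : 0 < n) (j : ℤ) (x : ℝ) (m : ℕ) :
    sopIntegral n j x (fun t => t ^ m) =
      ∑ l ∈ Finset.range (m + 1), (1 / (n : ℝ) ^ l) *
        (m.descFactorial l * (Ring.choose ((m : ℤ) - j) l : ℤ) * x ^ (m - l)) -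
      ∑ k ∈ Finset.range j.toNat, szasz n k x *
        ((m.factorial * (Ring.choose ((k : ℤ) + (m - j)) m : ℤ)) / (n : ℝ) ^ m) := by
  have hn' : (0 : ℝ) < n := by exact_mod_cast hn
  set u : ℕ → ℝ := fun k => szasz n k x *
    ((m.factorial * (Ring.choose ((k : ℤ) + (m - j)) m : ℤ)) / (n : ℝ) ^ m) with hu
  have hfull : HasSum u (∑ l ∈ Finset.range (m + 1), (1 / (n : ℝ) ^ l) *
      (m.descFactorial l * (Ring.choose ((m : ℤ) - j) l : ℤ) * x ^ (m - l))) := by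
    have h := hasSum_sum (s := Finset.range (m + 1)) fun s _ =>
      (hasSum_szasz_mul_descFactorial n s x).mul_left
        (m.factorial / (s.factorial * (n : ℝ) ^ m) * (Ring.choose ((m : ℤ) - j) (m - s) : ℤ))
    have hv : ∑ l ∈ Finset.range (m + 1), (1 / (n : ℝ) ^ l) *
        (m.descFactorial l * (Ring.choose ((m : ℤ) - j) l : ℤ) * x ^ (m - l)) =
        ∑ s ∈ Finset.range (m + 1), m.factorial / (s.factorial * (n : ℝ) ^ m) *
          (Ring.choose ((m : ℤ) - j) (m - s) : ℤ) * (n * x) ^ s := by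
      rw [← Finset.sum_range_reflect]
      refine Finset.sum_congr rfl fun s hs => ?_
      have hsm : s ≤ m := Nat.lt_succ_iff.1 (Finset.mem_range.1 hs)
      rw [show m + 1 - 1 - s = m - s by omega, Nat.sub_sub_self hsm,
        ← Nat.factorial_mul_descFactorial (Nat.sub_le m s), Nat.sub_sub_self hsm]
      have hp : (n : ℝ) ^ m = n ^ (m - s) * n ^ s := by rw [← pow_add, Nat.sub_add_cancel hsm]
      have := s.factorial_ne_zero
      rw [hp, mul_pow]
      push_cast
      field_simp
    rw [hv]
    refine h.congr_fun fun k => ?_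
    simp only [hu]
    rw [choose_add_eq_sum_range, Int.cast_sum, Finset.mul_sum, Finset.sum_div, Finset.mul_sum]
    refine Finset.sum_congr rfl fun s _ => ?_
    rw [Ring.choose_natCast, Nat.descFactorial_eq_factorial_mul_choose]
    have := s.factorial_ne_zero
    push_cast
    field_simp
  have hterm : ∀ k : ℕ, szasz n k x * (n * ∫ t in Set.Ioi (0 : ℝ), szaszZ n (k - j) t * t ^ m) =
      if k < j.toNat then 0 else u k := by
    intro k
    split_ifs with hk
    · have : (k : ℤ) - j < 0 := by omega
      simp [szaszZ_of_neg n this]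
    · have h0 : 0 ≤ (k : ℤ) - j := by omega
      obtain ⟨p, hp⟩ := Int.eq_ofNat_of_zero_le h0
      have h1 : (k : ℤ) + (m - j) = ((p + m : ℕ) : ℤ) := by push_cast; omega
      simp only [hu]
      rw [hp, mul_integral_szaszZ_mul_pow hn, h1, Ring.choose_natCast]
      have h2 := Nat.add_choose_mul_factorial_mul_factorial p m
      rw [← h2]
      have := p.factorial_ne_zero
      push_cast
      field_simp
  unfold sopIntegral
  simp only [hterm]
  have hs : HasSum (fun k => u k - if k < j.toNat then u k else 0) _ := hfull.sub
    (hasSum_sum_of_ne_finset_zero (s := Finset.range j.toNat)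
      (f := fun k => if k < j.toNat then u k else 0)
      fun k hk => if_neg (by simpa using hk))
  have e : (fun k => if k < j.toNat then 0 else u k) =
      fun k => u k - if k < j.toNat then u k else 0 := by
    ext k; split_ifs <;> simp
  rw [e, hs.tsum_eq]
  congr 1
  exact Finset.sum_congr rfl fun k hk => if_pos (Finset.mem_range.1 hk)

open Asymptotics Topology in
/-- Taylor expansion with Peano remainder, assuming only differentiability of the iterated
derivatives. -/
lemma taylor_peano {x : ℝ} (N : ℕ) (f : ℝ → ℝ)
    (h1 : ∀ i < N, ∀ᶠ y in 𝓝 x, DifferentiableAt ℝ (iteratedDeriv i f) y)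
    (h2 : DifferentiableAt ℝ (iteratedDeriv N f) x) :
    (fun y => f y - ∑ i ∈ Finset.range (N + 2),
      iteratedDeriv i f x / i.factorial * (y - x) ^ i) =o[𝓝 x] fun y => (y - x) ^ (N + 1) := by
  induction N generalizing f with
  | zero =>
    rw [iteratedDeriv_zero] at h2
    have := h2.hasDerivAt.isLittleO
    simpa [Finset.sum_range_succ, sub_sub, mul_comm] using this
  | succ N ih =>
    have ih' := ih (deriv f)
      (fun i hi => by simpa only [iteratedDeriv_succ'] using h1 (i + 1) (by omega))
      (by simpa only [iteratedDeriv_succ'] using h2)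
    simp only [← iteratedDeriv_succ'] at ih'
    have hd := h1 0 (Nat.succ_pos N)
    rw [iteratedDeriv_zero] at hd
    set F : ℝ → ℝ := fun y => f y - ∑ i ∈ Finset.range (N + 1 + 2),
      iteratedDeriv i f x / i.factorial * (y - x) ^ i with hF
    have hFx : F x = 0 := by
      simp only [hF, Finset.sum_range_succ' _ (N + 2), sub_self]
      simp
    have hFd : ∀ y, DifferentiableAt ℝ f y → HasDerivAt F
        (deriv f y - ∑ i ∈ Finset.range (N + 2),
          iteratedDeriv (i + 1) f x / i.factorial * (y - x) ^ i) y := by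
      intro y hy
      refine hy.hasDerivAt.sub ?_
      simp only [Finset.sum_range_succ' _ (N + 2), pow_zero, mul_one]
      refine HasDerivAt.add_const _ (HasDerivAt.fun_sum fun i _ => ?_)
      have h := (((hasDerivAt_id y).sub_const x).pow (i + 1)).const_mul
        (iteratedDeriv (i + 1) f x / (i + 1).factorial)
      refine h.congr_deriv ?_
      rw [Nat.factorial_succ]
      have := i.factorial_ne_zero
      push_cast
      simp
      field_simp
    rw [isLittleO_iff] at ih' ⊢
    intro c hc
    obtain ⟨δ, hδ, hball⟩ := Metric.eventually_nhds_iff_ball.1 ((ih' hc).and hd)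
    filter_upwards [Metric.ball_mem_nhds x hδ] with y hy
    have key := (convex_segment x y).norm_image_sub_le_of_norm_hasDerivWithin_le
      (C := c * |y - x| ^ (N + 1)) (f := F)
      (fun u hu => (hFd u (hball u ?_).2).hasDerivWithinAt) (fun u hu => ?_)
      (left_mem_segment ℝ x y) (right_mem_segment ℝ x y)
    · rw [hFx, sub_zero] at key
      refine key.trans_eq ?_
      rw [norm_pow, Real.norm_eq_abs]; ring
    · exact (convex_ball x δ).segment_subset (Metric.mem_ball_self hδ) hy hu
    · have hu' := (convex_ball x δ).segment_subset (Metric.mem_ball_self hδ) hy hu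
      refine (hball u hu').1.trans ?_
      rw [norm_pow, Real.norm_eq_abs]
      have : |u - x| ≤ |y - x| := by
        rw [segment_eq_uIcc] at hu
        exact Set.abs_sub_left_of_mem_uIcc hu
      gcongr

open Topology in
lemma tendsto_pow_mul_szasz (q k : ℕ) {x : ℝ} (hx : 0 < x) :
    Tendsto (fun n : ℕ => (n : ℝ) ^ q * szasz n k x) atTop (𝓝 0) := by
  have h1 : Tendsto (fun n : ℕ => (n : ℝ) * x) atTop atTop :=
    tendsto_natCast_atTop_atTop.atTop_mul_const hx
  have h := ((Real.tendsto_pow_mul_exp_neg_atTop_nhds_zero (q + k)).comp h1).mul_const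
    (1 / (x ^ q * k.factorial))
  rw [zero_mul] at h
  refine h.congr fun n => ?_
  simp only [Function.comp, szasz, pow_add, mul_pow, neg_mul]
  have := k.factorial_ne_zero
  field_simp

open Topology in
lemma tendsto_sopIntegral_pow (j : ℤ) (q m : ℕ) {x : ℝ} (hx : 0 < x) :
    Tendsto (fun n : ℕ => (n : ℝ) ^ q * (sopIntegral n j x (fun t => t ^ m) - x ^ m -
      ∑ k ∈ Finset.Icc 1 q, (1 / (n : ℝ) ^ k) *
        (m.descFactorial k * (Ring.choose ((m : ℤ) - j) k : ℤ) * x ^ (m - k)))) atTop (𝓝 0) := by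
  set d : ℕ → ℝ := fun k => m.descFactorial k * (Ring.choose ((m : ℤ) - j) k : ℤ) * x ^ (m - k)
    with hd
  have hinv : Tendsto (fun n : ℕ => 1 / (n : ℝ)) atTop (𝓝 0) := tendsto_one_div_atTop_nhds_zero_nat
  have h1 : Tendsto (fun n : ℕ => ∑ i ∈ Finset.range m, (1 / (n : ℝ)) ^ (i + 1) * d (q + 1 + i))
      atTop (𝓝 0) := by
    rw [← Finset.sum_const_zero (s := Finset.range m) (M := ℝ)]
    refine tendsto_finsetSum _ fun i _ => ?_
    simpa using (hinv.pow (i + 1)).mul_const (d (q + 1 + i))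
  have h2 : Tendsto (fun n : ℕ => ∑ k ∈ Finset.range j.toNat, (n : ℝ) ^ q * szasz n k x *
      ((1 / (n : ℝ)) ^ m * (m.factorial * (Ring.choose ((k : ℤ) + (m - j)) m : ℤ)))) atTop (𝓝 0) := by
    rw [← Finset.sum_const_zero (s := Finset.range j.toNat) (M := ℝ)]
    refine tendsto_finsetSum _ fun k _ => ?_
    simpa using (tendsto_pow_mul_szasz q k hx).mul ((hinv.pow m).mul_const
      ((m.factorial : ℝ) * (Ring.choose ((k : ℤ) + (m - j)) m : ℤ)))
  have h := h1.sub h2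
  rw [sub_zero] at h
  refine h.congr' ?_
  filter_upwards [eventually_gt_atTop 0] with n hn
  have hn' : (n : ℝ) ≠ 0 := by exact_mod_cast hn.ne'
  rw [sopIntegral_pow hn]
  have e1 : x ^ m + ∑ k ∈ Finset.Icc 1 q, (1 / (n : ℝ) ^ k) * d k =
      ∑ k ∈ Finset.range (q + 1), (1 / (n : ℝ) ^ k) * d k := by
    have : Finset.Icc 1 q = Finset.Ico (0 + 1) (q + 1) := by ext; simp
    rw [Finset.range_eq_Ico, Finset.sum_eq_sum_Ico_succ_bot q.succ_pos, this]
    simp [hd]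
  have e2 : ∑ l ∈ Finset.range (m + 1), (1 / (n : ℝ) ^ l) * d l =
      ∑ l ∈ Finset.range (q + 1 + m), (1 / (n : ℝ) ^ l) * d l := by
    refine Finset.sum_subset (Finset.range_mono (by omega)) fun l _ hl => ?_
    have : m < l := by simpa using hl
    simp [hd, Nat.descFactorial_of_lt this]
  rw [sub_sub, e1, e2, Finset.sum_range_add, sub_right_comm, add_sub_cancel_left, mul_sub,
    Finset.mul_sum, Finset.mul_sum]
  congr 1
  · refine Finset.sum_congr rfl fun i _ => ?_
    rw [show q + 1 + i = q + (i + 1) by ring, pow_add (n : ℝ), one_div_pow]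
    field_simp
  · refine Finset.sum_congr rfl fun k _ => ?_
    rw [one_div_pow]
    field_simp

open Asymptotics Topology in
/-- The operator applied to the Taylor remainder is `o(n ^ (-q))`. -/
lemma tendsto_sopIntegral_of_isLittleO (j : ℤ) (q : ℕ) {x : ℝ} (hx : 0 ≤ x) {r : ℝ → ℝ} {a K : ℝ}
    (ha : 0 ≤ a) (hK : 0 ≤ K) (hrm : AEStronglyMeasurable r (volume.restrict (Set.Ioi 0)))
    (hr : ∀ t > 0, |r t| ≤ K * Real.exp (a * t))
    (ho : r =o[𝓝 x] fun t => (t - x) ^ (2 * q)) :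
    Tendsto (fun n : ℕ => (n : ℝ) ^ q * sopIntegral n j x r) atTop (𝓝 0) := by
  set B : ℝ := 2 ^ (1 - j).natAbs * (2 * Real.exp (2 * x)) with hB
  have hB0 : 0 < B := by positivity
  rw [Metric.tendsto_atTop']
  intro η hη
  set ε : ℝ := η / (2 * ((2 * q).factorial * B)) with hε
  have hε0 : 0 < ε := by positivity
  obtain ⟨δ, hδ, hball⟩ := Metric.eventually_nhds_iff_ball.1 (isLittleO_iff.1 ho hε0)
  set M : ℝ := K * Real.exp (a * x) * (2 * q + 2).factorial * (2 / δ) ^ (2 * q + 2) with hM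
  have hM0 : 0 ≤ M := by positivity
  obtain ⟨N, hN⟩ := exists_nat_gt (max 4 (max (4 * a ^ 2) (2 * M * B / η)))
  refine ⟨N, fun n hn => ?_⟩
  have hNn : (N : ℝ) < n := by exact_mod_cast hn
  have hn4 : (4 : ℝ) < n := (le_max_left _ _).trans_lt (hN.trans hNn)
  have hna : 4 * a ^ 2 < n :=
    ((le_max_left _ _).trans (le_max_right _ _)).trans_lt (hN.trans hNn)
  have hnM : 2 * M * B / η < n :=
    ((le_max_right _ _).trans (le_max_right _ _)).trans_lt (hN.trans hNn)
  have hn0 : (0 : ℝ) < n := by linarith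
  set w := √(n : ℝ) with hw
  have hw2 : 2 ≤ w := Real.le_sqrt_of_sq_le (by linarith)
  have hwn : w ^ 2 = n := Real.sq_sqrt hn0.le
  have hwa : 2 * a ≤ w := Real.le_sqrt_of_sq_le (by nlinarith)
  have hw0 : 0 < w := by linarith
  have hW : ∀ t, Real.exp (w * |t - x|) ≤ Real.exp (w * (t - x)) + Real.exp (-w * (t - x)) := by
    intro t
    rcases abs_cases (t - x) with ⟨h, -⟩ | ⟨h, -⟩
    · rw [h]; linarith [Real.exp_pos (-w * (t - x))]
    · rw [h, show w * -(t - x) = -w * (t - x) by ring]; linarith [Real.exp_pos (w * (t - x))]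
  have hbound : ∀ t > 0, |r t| ≤ (ε * (2 * q).factorial + M / n) / (n : ℝ) ^ q *
      (Real.exp (w * (t - x)) + Real.exp (-w * (t - x))) := by
    intro t ht
    refine le_trans ?_ (mul_le_mul_of_nonneg_left (hW t) (by positivity))
    have hy : 0 ≤ |t - x| := abs_nonneg _
    rcases lt_or_ge |t - x| δ with h | h
    · have h1 := hball t (by rwa [Metric.mem_ball, Real.dist_eq])
      rw [norm_pow, Real.norm_eq_abs, Real.norm_eq_abs] at h1
      have h2 := Real.pow_div_factorial_le_exp (w * |t - x|) (by positivity) (2 * q)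
      rw [div_le_iff₀ (by positivity), mul_pow, pow_mul w, hwn] at h2
      calc |r t| ≤ ε * (((n : ℝ) ^ q * |t - x| ^ (2 * q)) / (n : ℝ) ^ q) := by
            refine h1.trans_eq ?_
            field_simp
        _ ≤ ε * ((Real.exp (w * |t - x|) * (2 * q).factorial) / (n : ℝ) ^ q) := by gcongr
        _ = (ε * (2 * q).factorial + 0) / (n : ℝ) ^ q * Real.exp (w * |t - x|) := by ring
        _ ≤ _ := by gcongr; positivity
    · have h2 := Real.pow_div_factorial_le_exp (w / 2 * |t - x|) (by positivity) (2 * q + 2)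
      rw [div_le_iff₀ (by positivity)] at h2
      have h3 : (w / 2 * δ) ^ (2 * q + 2) ≤
          Real.exp (w / 2 * |t - x|) * (2 * q + 2).factorial := le_trans (by gcongr) h2
      have h4 : Real.exp (a * t) ≤ Real.exp (a * x) * Real.exp (w / 2 * |t - x|) := by
        rw [← Real.exp_add]
        apply Real.exp_le_exp.2
        have := le_abs_self (t - x)
        nlinarith
      have h5 : Real.exp (w * |t - x|) =
          Real.exp (w / 2 * |t - x|) * Real.exp (w / 2 * |t - x|) := by
        rw [← Real.exp_add]; ring_nf
      have h6 : (w / 2 * δ) ^ (2 * q + 2) * (2 / δ) ^ (2 * q + 2) = (n : ℝ) ^ q * n := by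
        rw [← mul_pow, show w / 2 * δ * (2 / δ) = w by field_simp,
          show 2 * q + 2 = 2 * (q + 1) by ring, pow_mul, hwn, pow_succ]
      calc |r t| ≤ K * Real.exp (a * t) := hr t ht
        _ ≤ K * (Real.exp (a * x) * Real.exp (w / 2 * |t - x|)) := by gcongr
        _ = K * (Real.exp (a * x) * Real.exp (w / 2 * |t - x|)) *
            ((w / 2 * δ) ^ (2 * q + 2) * (2 / δ) ^ (2 * q + 2)) / ((n : ℝ) ^ q * n) := by
            rw [h6]; field_simp
        _ ≤ K * (Real.exp (a * x) * Real.exp (w / 2 * |t - x|)) *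
            ((Real.exp (w / 2 * |t - x|) * (2 * q + 2).factorial) * (2 / δ) ^ (2 * q + 2)) /
              ((n : ℝ) ^ q * n) := by gcongr
        _ = (0 + M / n) / (n : ℝ) ^ q * Real.exp (w * |t - x|) := by
            rw [h5, hM]; field_simp; ring
        _ ≤ _ := by gcongr; positivity
  have hL := (admissible_of_le_exp_sqrt hw2 hwn j hx hrm hbound).2
  rw [← hB] at hL
  rw [Real.dist_eq, sub_zero, abs_mul, abs_of_nonneg (by positivity)]
  calc (n : ℝ) ^ q * |sopIntegral n j x r|
      ≤ (n : ℝ) ^ q * ((ε * (2 * q).factorial + M / n) / (n : ℝ) ^ q * B) := by gcongr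
    _ = ε * (2 * q).factorial * B + M * B / n := by field_simp
    _ < η / 2 + η / 2 := by
        refine add_lt_add_of_le_of_lt (le_of_eq ?_) ?_
        · rw [hε]; field_simp
        · rw [div_lt_iff₀ hη] at hnM
          rw [div_lt_iff₀ hn0]; linarith
    _ = η := by ring

/-- Complete asymptotic expansion: for `f ∈ E` having a derivative of order
`2q` at `x > 0`, the expansion of `(S_{n,j}f)(x)` holds up to order `n^{-q}`. -/
theorem stmt_13 (j : ℤ) (q : ℕ) (hq : 1 ≤ q) (x : ℝ) (hx : 0 < x) (f : ℝ → ℝ)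
    (hfE : ∃ A ≥ (0 : ℝ), MemE A f)
    (hdiff : ∃ U ∈ nhds x,
      (∀ i < 2 * q - 1, ∀ y ∈ U, DifferentiableAt ℝ (iteratedDeriv i f) y) ∧
      DifferentiableAt ℝ (iteratedDeriv (2 * q - 1) f) x) :
    Filter.Tendsto (fun n : ℕ => (n : ℝ) ^ q *
      (Sop n j f x - f x - ∑ k ∈ Finset.Icc 1 q,
        (1 / ((Nat.factorial k : ℝ) * (n : ℝ) ^ k)) *
          ((Nat.factorial k : ℝ) * ∑ s ∈ Finset.range (k + 1),
            (x ^ s / (Nat.factorial s)) *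
              ((ffall ((k : ℤ) - j) (k - s) : ℝ) / (Nat.factorial (k - s))) *
              iteratedDeriv (k + s) f x)))
      Filter.atTop (nhds 0) := by
  obtain ⟨A, hA, hfL, K, hK, hfK⟩ := hfE
  obtain ⟨U, hU, hUd, hxd⟩ := hdiff
  set P : Polynomial ℝ := ∑ i ∈ Finset.range (2 * q + 1),
    Polynomial.C (iteratedDeriv i f x / i.factorial) * (Polynomial.X - Polynomial.C x) ^ i with hP
  have hPeval : ∀ t, P.eval t = ∑ i ∈ Finset.range (2 * q + 1),
      iteratedDeriv i f x / i.factorial * (t - x) ^ i := fun t => by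
    simp [hP, Polynomial.eval_finsetSum]
  set D : ℕ := P.natDegree + 1 with hD
  have hPsum : ∀ t, P.eval t = ∑ m ∈ Finset.range D, P.coeff m * t ^ m := fun t =>
    Polynomial.eval_eq_sum_range t
  have hder : ∀ i ≤ 2 * q, iteratedDeriv i f x =
      ∑ m ∈ Finset.range D, P.coeff m * (m.descFactorial i * x ^ (m - i)) := by
    intro i hi
    have h1 : (Polynomial.derivative^[i] P).eval x = iteratedDeriv i f x := by
      rw [hP, Polynomial.iterate_derivative_sum, Polynomial.eval_finsetSum,
        Finset.sum_eq_single i]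
      · have := i.factorial_ne_zero
        simp [Polynomial.iterate_derivative_C_mul, Polynomial.iterate_derivative_X_sub_pow]
        rw [Nat.descFactorial_self]
        field_simp
      · intro m _ hmi
        rw [Polynomial.iterate_derivative_C_mul, Polynomial.iterate_derivative_X_sub_pow]
        rcases lt_or_gt_of_ne hmi with h | h
        · simp [Nat.descFactorial_of_lt h]
        · simp [Nat.sub_ne_zero_of_lt h]
      · intro h
        exact absurd (Finset.mem_range.2 (by omega)) h
    rw [← h1]
    conv_lhs => rw [P.as_sum_range_C_mul_X_pow]
    rw [Polynomial.iterate_derivative_sum, Polynomial.eval_finsetSum]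
    refine Finset.sum_congr rfl fun m _ => ?_
    simp [Polynomial.iterate_derivative_C_mul, Polynomial.iterate_derivative_X_pow_eq_natCast_mul]
  set r : ℝ → ℝ := fun t => f t - P.eval t with hr
  have hro : r =o[nhds x] fun t => (t - x) ^ (2 * q) := by
    have h := taylor_peano (2 * q - 1) f
      (fun i hi => by filter_upwards [hU] with y hy using hUd i hi y hy) hxd
    rw [show 2 * q - 1 + 2 = 2 * q + 1 by omega, show 2 * q - 1 + 1 = 2 * q by omega] at h
    simpa only [hr, hPeval] using h
  have hfm : AEStronglyMeasurable f (volume.restrict (Set.Ioi 0)) :=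
    hfL.aestronglyMeasurable.mono_measure (Measure.restrict_mono Set.Ioi_subset_Ici_self le_rfl)
  have hrm : AEStronglyMeasurable r (volume.restrict (Set.Ioi 0)) :=
    hfm.sub P.continuous.aestronglyMeasurable
  have hmono : ∀ m : ℕ, ∀ t > (0 : ℝ), |t ^ m| ≤ m.factorial * Real.exp (1 * t) := by
    intro m t ht
    have h := Real.pow_div_factorial_le_exp t ht.le m
    rw [div_le_iff₀ (by positivity)] at h
    rw [abs_of_pos (pow_pos ht m), one_mul]; linarith
  set K' : ℝ := K + ∑ m ∈ Finset.range D, |P.coeff m| * m.factorial with hK'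
  have hK'0 : 0 ≤ K' := by positivity
  have hrK : ∀ t > 0, |r t| ≤ K' * Real.exp ((A + 1) * t) := by
    intro t ht
    have h1 : |f t| ≤ K * Real.exp ((A + 1) * t) := (hfK t ht.le).trans (by gcongr; linarith)
    have h2 : |P.eval t| ≤
        (∑ m ∈ Finset.range D, |P.coeff m| * m.factorial) * Real.exp ((A + 1) * t) := by
      rw [hPsum, Finset.sum_mul]
      refine (Finset.abs_sum_le_sum_abs _ _).trans (Finset.sum_le_sum fun m _ => ?_)
      rw [abs_mul, mul_assoc]
      gcongr
      refine (hmono m t ht).trans ?_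
      gcongr
      linarith
    rw [hK', add_mul]
    exact (abs_sub _ _).trans (add_le_add h1 h2)
  have t1 := tendsto_sopIntegral_of_isLittleO j q hx.le (by linarith : 0 ≤ A + 1) hK'0 hrm hrK hro
  have t2 : Tendsto (fun n : ℕ => f 0 * ∑ k ∈ Finset.range j.toNat, (n : ℝ) ^ q * szasz n k x)
      atTop (nhds (f 0 * ∑ k ∈ Finset.range j.toNat, 0)) :=
    (tendsto_finsetSum _ fun k _ => tendsto_pow_mul_szasz q k hx).const_mul _
  have t3 := tendsto_finsetSum (Finset.range D) fun m _ =>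
    (tendsto_sopIntegral_pow j q m hx).const_mul (P.coeff m)
  have t := (t1.add t2).add t3
  simp only [Finset.sum_const_zero, mul_zero, add_zero] at t
  refine t.congr' ?_
  obtain ⟨N, hN⟩ := exists_nat_gt (max 4 ((A + 1) ^ 2))
  filter_upwards [eventually_ge_atTop N] with n hn
  have hNn : (N : ℝ) ≤ n := by exact_mod_cast hn
  have hn4 : 4 ≤ n := by
    have : (4 : ℝ) ≤ n := ((le_max_left _ _).trans hN.le).trans hNn
    exact_mod_cast this
  have hnA : (A + 1) ^ 2 ≤ n := ((le_max_right _ _).trans hN.le).trans hNn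
  have hn0 : (n : ℝ) ≠ 0 := by
    have : n ≠ 0 := by omega
    exact_mod_cast this
  have ar := admissible_of_le_exp hn4 (by linarith) hnA j hx.le hK'0 hrm hrK
  have am := Admissible.sum (Finset.range D) (fun m => P.coeff m) (fun m t => t ^ m) fun m _ =>
    admissible_of_le_exp hn4 zero_le_one (by nlinarith) j hx.le (by positivity)
      (continuous_pow m).aestronglyMeasurable (hmono m)
  have hfL' := (ar.add am.1).2
  have hfe : (fun t => r t + ∑ m ∈ Finset.range D, P.coeff m * t ^ m) = f := by
    ext t; rw [← hPsum]; simp [hr]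
  rw [hfe, am.2] at hfL'
  have hS : Sop n j f x = f 0 * ∑ k ∈ Finset.range j.toNat, szasz n k x + sopIntegral n j x f := rfl
  have hfx : f x = ∑ m ∈ Finset.range D, P.coeff m * x ^ m := by
    simpa using hder 0 (Nat.zero_le _)
  have hc : ∀ k ∈ Finset.Icc 1 q, (1 / ((Nat.factorial k : ℝ) * (n : ℝ) ^ k)) *
      ((Nat.factorial k : ℝ) * ∑ s ∈ Finset.range (k + 1), (x ^ s / (Nat.factorial s)) *
        ((ffall ((k : ℤ) - j) (k - s) : ℝ) / (Nat.factorial (k - s))) *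
          iteratedDeriv (k + s) f x) =
      ∑ m ∈ Finset.range D, P.coeff m * ((1 / (n : ℝ) ^ k) *
        (m.descFactorial k * (Ring.choose ((m : ℤ) - j) k : ℤ) * x ^ (m - k))) := by
    intro k hk
    have hkq := (Finset.mem_Icc.1 hk).2
    simp only [← sum_choose_mul_descFactorial]
    have := k.factorial_ne_zero
    rw [← mul_assoc, show 1 / ((k.factorial : ℝ) * (n : ℝ) ^ k) * k.factorial = 1 / (n : ℝ) ^ k by
      field_simp]
    simp only [Finset.mul_sum]
    rw [Finset.sum_comm]
    refine Finset.sum_congr rfl fun s hs => ?_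
    have := Finset.mem_range.1 hs
    rw [hder (k + s) (by omega), Finset.mul_sum, Finset.mul_sum]
    exact Finset.sum_congr rfl fun m _ => by ring
  rw [Finset.sum_congr rfl hc, Finset.sum_comm, hS, hfL', hfx]
  simp only [← Finset.mul_sum]
  have e : ∀ a b c d : ℕ → ℝ, ∑ m ∈ Finset.range D, a m * ((n : ℝ) ^ q * (b m - c m - d m)) =
      (n : ℝ) ^ q * (∑ m ∈ Finset.range D, a m * b m - ∑ m ∈ Finset.range D, a m * c m -
        ∑ m ∈ Finset.range D, a m * d m) := fun a b c d => by
    rw [← Finset.sum_sub_distrib, ← Finset.sum_sub_distrib, Finset.mul_sum]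
    exact Finset.sum_congr rfl fun m _ => by ring
  rw [e]
  ring
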